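/- Let Γ be a connected metric graph of first Betti number b ≥ 2 and total length b. Let n ∈ {1,...,b}. Then there exist at least n homologically independent loops in Γ based at the same point, each of length at most 24(log(b) + n). -/

import Mathlib

/-- A metric graph: a finite graph (multiple edges and loops allowed) with a
nonnegative length assigned to each edge. -/
structure MGraph where
  V : Type
  E : Type
  fV : Fintype V
  fE : Fintype E
  deV : DecidableEq V
  deE : DecidableEq E
  s : E → V
  t : E → V
  len : E → ℝ
  len_nonneg : ∀ e, 0 ≤ len e

attribute [instance] MGraph.fV MGraph.fE MGraph.deV MGraph.deE

namespace MGraph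

variable (G : MGraph)

/-- The total length (one-dimensional Hausdorff measure) of the metric graph. -/
def totalLength : ℝ := ∑ e, G.len e

/-- A dart is an edge together with an orientation. -/
def dstart (d : G.E × Bool) : G.V := if d.2 then G.s d.1 else G.t d.1

def dend (d : G.E × Bool) : G.V := if d.2 then G.t d.1 else G.s d.1

/-- `G.IsWalk u v l` : the list of darts `l` is a walk from `u` to `v`. -/
def IsWalk : G.V → G.V → List (G.E × Bool) → Prop
  | u, v, [] => u = v
  | u, v, d :: l => G.dstart d = u ∧ IsWalk (G.dend d) v l

/-- The length of a walk. -/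
def walkLen (l : List (G.E × Bool)) : ℝ := (l.map fun d => G.len d.1).sum

/-- The real cycle vector of a closed walk: its class in `H₁(Γ, ℝ) ⊆ ℝ^E`, recording
the signed number of times each edge is traversed. A family of loops is homologically
independent iff their cycle vectors are linearly independent. -/
def cycVec (l : List (G.E × Bool)) : G.E → ℝ := fun e =>
  (l.map fun d => if d.1 = e then (if d.2 then (1 : ℝ) else -1) else 0).sum

/-- The graph is connected. -/
def Connected : Prop := ∀ u v : G.V, ∃ l, G.IsWalk u v l

/-- `G.bettiEq b` : the first Betti number `e - v + 1` of the connected graph `G`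
equals `b`. -/
def bettiEq (b : ℕ) : Prop :=
  (Fintype.card G.E : ℤ) - (Fintype.card G.V : ℤ) + 1 = (b : ℤ)

/-- The path distance between two vertices. -/
noncomputable def vdist (u v : G.V) : ℝ :=
  sInf {x | ∃ l, G.IsWalk u v l ∧ G.walkLen l = x}

/-- The list of vertices visited by a walk. -/
def walkVerts (l : List (G.E × Bool)) : List G.V := l.map G.dstart

/-- The distance from a vertex to a (nonempty) walk. -/
noncomputable def distToWalk (x : G.V) (l : List (G.E × Bool)) : ℝ :=
  sInf {d | ∃ v ∈ G.walkVerts l, G.vdist x v = d}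

/-- The distance between two loops. -/
noncomputable def loopDist (l₁ l₂ : List (G.E × Bool)) : ℝ :=
  sInf {d | ∃ u ∈ G.walkVerts l₁, ∃ v ∈ G.walkVerts l₂, G.vdist u v = d}

/-- A simple loop (embedded circle): a nonempty closed walk repeating no edge and
no vertex. -/
def IsSimpleLoop (l : List (G.E × Bool)) : Prop :=
  l ≠ [] ∧ (∃ v, G.IsWalk v v l) ∧ (l.map Prod.fst).Nodup ∧ (G.walkVerts l).Nodup

end MGraph

namespace MGraph

variable {G : MGraph}

lemma IsWalk.append : ∀ {l m : List (G.E × Bool)} {u v w : G.V},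
    G.IsWalk u v l → G.IsWalk v w m → G.IsWalk u w (l ++ m)
  | [], m, u, v, w, h1, h2 => by
      have h : u = v := h1
      subst h; exact h2
  | d :: l, m, u, v, w, h1, h2 => ⟨h1.1, IsWalk.append h1.2 h2⟩

/-- The reversed walk. -/
def rev (l : List (G.E × Bool)) : List (G.E × Bool) :=
  (l.map (fun d => (d.1, !d.2))).reverse

lemma rev_cons (d : G.E × Bool) (l : List (G.E × Bool)) :
    rev (d :: l) = rev l ++ [(d.1, !d.2)] := by simp [rev]

lemma IsWalk.rev : ∀ {l : List (G.E × Bool)} {u v : G.V},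
    G.IsWalk u v l → G.IsWalk v u (rev l)
  | [], u, v, h1 => Eq.symm h1
  | d :: l, u, v, h1 => by
      rw [rev_cons]
      refine (IsWalk.rev h1.2).append ?_
      obtain ⟨e, b⟩ := d
      have := h1.1
      cases b <;> simpa [IsWalk, dstart, dend] using this

lemma walkLen_append (l m : List (G.E × Bool)) :
    G.walkLen (l ++ m) = G.walkLen l + G.walkLen m := by simp [walkLen]

lemma walkLen_rev (l : List (G.E × Bool)) : G.walkLen (rev l) = G.walkLen l := by
  simp [walkLen, rev, List.sum_reverse, Function.comp_def]

lemma walkLen_single (d : G.E × Bool) : G.walkLen [d] = G.len d.1 := by simp [walkLen]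

lemma walkLen_nonneg (l : List (G.E × Bool)) : 0 ≤ G.walkLen l := by
  apply List.sum_nonneg
  intro x hx
  obtain ⟨d, -, rfl⟩ := List.mem_map.1 hx
  exact G.len_nonneg _

lemma cycVec_append (l m : List (G.E × Bool)) :
    G.cycVec (l ++ m) = G.cycVec l + G.cycVec m := by
  funext e; simp [cycVec]

lemma cycVec_rev (l : List (G.E × Bool)) : G.cycVec (rev l) = - G.cycVec l := by
  induction l with
  | nil => funext e; simp [cycVec, rev]
  | cons d l ih =>
    rw [rev_cons, cycVec_append, ih, show d :: l = [d] ++ l from rfl, cycVec_append, neg_add,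
      add_comm]
    congr 1
    funext e
    obtain ⟨e', b⟩ := d
    cases b <;> by_cases h : e' = e <;> simp [cycVec, h]

lemma cycVec_single (e : G.E) : G.cycVec [(e, true)] = Pi.single e 1 := by
  funext e'
  by_cases h : e = e'
  · subst h; simp [cycVec]
  · simp [cycVec, h, Ne.symm h]

lemma vdist_le {u v : G.V} {l : List (G.E × Bool)} (h : G.IsWalk u v l) :
    G.vdist u v ≤ G.walkLen l :=
  csInf_le ⟨0, by rintro _ ⟨m, -, rfl⟩; exact walkLen_nonneg m⟩ ⟨l, h, rfl⟩

lemma vdist_nonneg (u v : G.V) : 0 ≤ G.vdist u v :=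
  Real.sInf_nonneg (by rintro _ ⟨m, -, rfl⟩; exact walkLen_nonneg m)

lemma vdist_self (u : G.V) : G.vdist u u = 0 :=
  le_antisymm (by simpa [walkLen] using vdist_le (G := G) (u := u) (v := u) (l := []) rfl)
    (vdist_nonneg _ _)

lemma exists_walk (hc : G.Connected) (u v : G.V) {η : ℝ} (hη : 0 < η) :
    ∃ l, G.IsWalk u v l ∧ G.walkLen l < G.vdist u v + η := by
  obtain ⟨l, hl⟩ := hc u v
  obtain ⟨_, ⟨m, hm, rfl⟩, h⟩ := exists_lt_of_csInf_lt
    (s := {x | ∃ l, G.IsWalk u v l ∧ G.walkLen l = x}) ⟨_, l, hl, rfl⟩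
    (lt_add_of_pos_right (G.vdist u v) hη)
  exact ⟨m, hm, h⟩

lemma vdist_comm (hc : G.Connected) (u v : G.V) : G.vdist u v = G.vdist v u := by
  have key : ∀ u v : G.V, G.vdist u v ≤ G.vdist v u := by
    intro u v
    apply le_of_forall_pos_le_add
    intro η hη
    obtain ⟨l, hl, h⟩ := exists_walk hc v u hη
    have := vdist_le hl.rev
    rw [walkLen_rev] at this
    linarith
  exact le_antisymm (key _ _) (key _ _)

lemma vdist_triangle (hc : G.Connected) (u v w : G.V) :
    G.vdist u w ≤ G.vdist u v + G.vdist v w := by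
  apply le_of_forall_pos_le_add
  intro η hη
  obtain ⟨l, hl, h⟩ := exists_walk hc u v (half_pos hη)
  obtain ⟨m, hm, h'⟩ := exists_walk hc v w (half_pos hη)
  have := vdist_le (hl.append hm)
  rw [walkLen_append] at this
  linarith

lemma vdist_edge (e : G.E) : G.vdist (G.s e) (G.t e) ≤ G.len e := by
  have := vdist_le (G := G) (u := G.s e) (v := G.t e) (l := [(e, true)])
    (by simp [IsWalk, dstart, dend])
  simpa [walkLen] using this

lemma abs_vdist_edge (hc : G.Connected) (x : G.V) (e : G.E) :
    |G.vdist x (G.s e) - G.vdist x (G.t e)| ≤ G.len e := by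
  have h1 := vdist_edge e
  have h2 := vdist_triangle hc x (G.s e) (G.t e)
  have h3 := vdist_triangle hc x (G.t e) (G.s e)
  rw [vdist_comm hc (G.t e)] at h3
  rw [abs_le]; constructor <;> linarith

lemma hasDeriv_clamp (a b r : ℝ) :
    HasDerivWithinAt (fun r => |min a r - min b r|)
      (if ¬ (a ≤ r ↔ b ≤ r) then (1 : ℝ) else 0) (Set.Ici r) r := by
  have main : ∀ a b : ℝ, a ≤ r → r < b →
      HasDerivWithinAt (fun r => |min a r - min b r|) 1 (Set.Ici r) r := by
    intro a b ha hb
    have h : HasDerivWithinAt (fun y : ℝ => y - a) 1 (Set.Ici r) r :=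
      ((hasDerivAt_id r).sub_const a).hasDerivWithinAt
    refine h.congr_of_eventuallyEq ?_ ?_
    · filter_upwards [self_mem_nhdsWithin, mem_nhdsWithin_of_mem_nhds (Iio_mem_nhds hb)]
        with y hy hy'
      have hy1 : r ≤ y := hy
      have hy2 : y < b := hy'
      rw [min_eq_left (ha.trans hy1), min_eq_right hy2.le, abs_sub_comm, abs_of_nonneg]
      linarith
    · rw [min_eq_left ha, min_eq_right hb.le, abs_sub_comm, abs_of_nonneg]
      linarith
  rcases le_or_gt a r with ha | ha <;> rcases le_or_gt b r with hb | hb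
  · rw [if_neg (by simp [ha, hb])]
    refine (hasDerivWithinAt_const r _ (|a - b|)).congr ?_ ?_
    · intro y hy
      have hy1 : r ≤ y := hy
      simp only [min_eq_left (ha.trans hy1), min_eq_left (hb.trans hy1)]
    · simp only [min_eq_left ha, min_eq_left hb]
  · rw [if_pos (by simp [ha, hb])]
    exact main a b ha hb
  · rw [if_pos (by simp [ha, hb])]
    have := main b a hb ha
    simpa only [abs_sub_comm] using this
  · rw [if_neg (by simp [not_le.2 ha, not_le.2 hb])]
    refine (hasDerivWithinAt_const r _ (0 : ℝ)).congr_of_eventuallyEq ?_ ?_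
    · filter_upwards [mem_nhdsWithin_of_mem_nhds (Iio_mem_nhds hb),
        mem_nhdsWithin_of_mem_nhds (Iio_mem_nhds ha)] with y hy hy'
      have hy1 : y < b := hy
      have hy2 : y < a := hy'
      simp [min_eq_right hy1.le, min_eq_right hy2.le]
    · simp [min_eq_right ha.le, min_eq_right hb.le]

/-- Length of the part of `F` within the ball of radius `r`. -/
noncomputable def vol (d : G.V → ℝ) (F : Finset G.E) (r : ℝ) : ℝ :=
  ∑ e ∈ F, |min (d (G.s e)) r - min (d (G.t e)) r|

open Classical in
/-- Edges of `F` cut at radius `r`. -/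
noncomputable def crossing (d : G.V → ℝ) (F : Finset G.E) (r : ℝ) : Finset G.E :=
  F.filter fun e => ¬ (d (G.s e) ≤ r ↔ d (G.t e) ≤ r)

lemma hasDeriv_vol (d : G.V → ℝ) (F : Finset G.E) (r : ℝ) :
    HasDerivWithinAt (vol d F) ((crossing d F r).card : ℝ) (Set.Ici r) r := by
  have h := HasDerivWithinAt.fun_sum (u := F)
    (fun e _ => hasDeriv_clamp (d (G.s e)) (d (G.t e)) r)
  have h2 : ((crossing d F r).card : ℝ) = ∑ e ∈ F,
      (if ¬ (d (G.s e) ≤ r ↔ d (G.t e) ≤ r) then (1 : ℝ) else 0) := by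
    rw [crossing, Finset.card_filter]
    push_cast
    apply Finset.sum_congr rfl
    intro e _
    congr
  rw [h2]
  exact h

lemma continuous_vol (d : G.V → ℝ) (F : Finset G.E) : Continuous (vol d F) := by
  unfold vol; fun_prop

lemma mono_right {f f' : ℝ → ℝ} {a b : ℝ} (hab : a ≤ b) (hf : ContinuousOn f (Set.Icc a b))
    (hd : ∀ x ∈ Set.Ico a b, HasDerivWithinAt f (f' x) (Set.Ici x) x)
    (h0 : ∀ x ∈ Set.Ico a b, 0 ≤ f' x) : f a ≤ f b := by
  have := image_le_of_deriv_right_le_deriv_boundary (f := fun x => - f x) (f' := fun x => - f' x)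
    (a := a) (b := b) hf.neg (fun x hx => (hd x hx).neg) (B := fun _ => - f a) (B' := fun _ => 0)
    le_rfl continuousOn_const (fun x _ => hasDerivWithinAt_const _ _ _)
    (fun x hx => by have := h0 x hx; simpa using this) (Set.right_mem_Icc.2 hab)
  simpa using this

lemma vol_nonneg (d : G.V → ℝ) (F : Finset G.E) (r : ℝ) : 0 ≤ vol d F r :=
  Finset.sum_nonneg fun _ _ => abs_nonneg _

lemma clamp_le (a b r : ℝ) : |min a r - min b r| ≤ |a - b| := by
  simpa using abs_min_sub_min_le_max a r b r

/-- A ball with some vertex outside has length at least its radius. -/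
lemma vol_ge (x y : G.V) (hc : G.Connected) {ρ : ℝ} (hρ : 0 ≤ ρ) (hy : ρ ≤ G.vdist x y) :
    ρ ≤ vol (G.vdist x) Finset.univ ρ := by
  have h := mono_right (f := fun r => vol (G.vdist x) Finset.univ r - r)
    (f' := fun r => ((crossing (G.vdist x) Finset.univ r).card : ℝ) - 1) hρ
    ((continuous_vol _ _).sub continuous_id).continuousOn
    (fun r _ => (hasDeriv_vol _ _ r).sub (hasDerivWithinAt_id _ _)) ?_
  · have := vol_nonneg (G.vdist x) Finset.univ 0
    simp only [sub_zero] at h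
    linarith
  · intro r hr
    have key : ∀ (l : List (G.E × Bool)) (u v : G.V), G.IsWalk u v l → G.vdist x u ≤ r →
        r < G.vdist x v → (crossing (G.vdist x) Finset.univ r).Nonempty := by
      intro l
      induction l with
      | nil =>
        intro u v h h1 h2
        have h' : u = v := h
        subst h'; linarith
      | cons d l ih =>
        intro u v h h1 h2
        by_cases hd : G.vdist x (G.dend d) ≤ r
        · exact ih _ _ h.2 hd h2
        · refine ⟨d.1, ?_⟩
          have h3 := h.1
          rw [← h3] at h1
          obtain ⟨e, b⟩ := d
          cases b <;> simp [crossing, dstart, dend] at * <;> grind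
    obtain ⟨l, hl⟩ := hc x y
    have := (key l x y hl (by rw [vdist_self]; exact hr.1) (hr.2.trans_le hy)).card_pos
    have : (1 : ℝ) ≤ (crossing (G.vdist x) Finset.univ r).card := by exact_mod_cast this
    linarith

/-- Region growing. -/
lemma exists_radius (d : G.V → ℝ) (F : Finset G.E) {a δ ε σ : ℝ} (hδ : 0 ≤ δ)
    (hbig : ∀ r, σ + vol d F r < Real.exp (ε * δ) * σ) :
    ∃ r, a ≤ r ∧ r ≤ a + δ ∧ ((crossing d F r).card : ℝ) ≤ ε * (σ + vol d F r) := by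
  by_contra! hcon
  have hd : ∀ r, HasDerivWithinAt (fun r => Real.exp (-ε * r) * (σ + vol d F r))
      (Real.exp (-ε * r) * (-ε) * (σ + vol d F r) +
        Real.exp (-ε * r) * ((crossing d F r).card : ℝ)) (Set.Ici r) r := by
    intro r
    have h1 : HasDerivAt (fun r : ℝ => Real.exp (-ε * r)) (Real.exp (-ε * r) * (-ε)) r := by
      simpa using ((hasDerivAt_id r).const_mul (-ε)).exp
    exact h1.hasDerivWithinAt.mul ((hasDeriv_vol d F r).const_add σ)
  have hcont := continuous_vol d F
  have h := mono_right (a := a) (b := a + δ) (by linarith)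
    (by fun_prop) (fun r _ => hd r) (by
      intro r hr
      have := hcon r hr.1 hr.2.le
      have h2 := Real.exp_pos (-ε * r)
      nlinarith)
  have h1 := hbig (a + δ)
  have h2 := vol_nonneg d F a
  have h3 : Real.exp (-ε * a) = Real.exp (-ε * (a + δ)) * Real.exp (ε * δ) := by
    rw [← Real.exp_add]; congr 1; ring
  simp only [h3] at h
  rw [mul_assoc] at h
  have h4 := le_of_mul_le_mul_left h (Real.exp_pos _)
  have h5 := Real.exp_pos (ε * δ)
  nlinarith

end MGraph
namespace MGraph

variable {G : MGraph}

/-- Linear algebra: rank of the family of loops through the edges of `F`. -/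
lemma rank_lemma (C : Finset G.V) (F : Finset G.E) (hF : ∀ e ∈ F, G.s e ∈ C ∧ G.t e ∈ C)
    (p : G.V → G.E → ℝ) (n : ℕ) (hC : C.Nonempty) (hn : C.card + n ≤ F.card + 1) :
    ∃ a : Fin n → F, LinearIndependent ℝ
      (fun i => (Pi.single (a i : G.E) 1 + p (G.s (a i)) - p (G.t (a i)) : G.E → ℝ)) := by
  classical
  obtain ⟨c0, hc0⟩ := hC
  let w : F → G.E → ℝ := fun e => Pi.single (e : G.E) 1 + p (G.s e) - p (G.t e)
  let bd : (F → ℝ) →ₗ[ℝ] (G.V → ℝ) :=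
    Fintype.linearCombination ℝ (fun e : F =>
      (Pi.single (G.s e) 1 - Pi.single (G.t e) 1 : G.V → ℝ))
  let L : (F → ℝ) →ₗ[ℝ] (G.E → ℝ) := Fintype.linearCombination ℝ w
  have hbd : ∀ z v, bd z v = ∑ e : F, z e * ((if v = G.s e then 1 else 0) -
      (if v = G.t e then 1 else 0)) := by
    intro z v
    simp [bd, Fintype.linearCombination_apply, Finset.sum_apply, Pi.single_apply]
  have hL : ∀ z, L z = (∑ e : F, z e • (Pi.single (e : G.E) (1 : ℝ) : G.E → ℝ)) +
      ∑ v ∈ C, bd z v • p v := by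
    intro z
    have h1 : ∑ v ∈ C, bd z v • p v = ∑ e : F, z e • (p (G.s e) - p (G.t e)) := by
      simp_rw [hbd, Finset.sum_smul]
      rw [Finset.sum_comm]
      apply Finset.sum_congr rfl
      intro e _
      simp_rw [mul_smul]
      rw [← Finset.smul_sum]
      congr 1
      simp_rw [sub_smul, ite_smul, one_smul, zero_smul]
      rw [Finset.sum_sub_distrib, Finset.sum_ite_eq', Finset.sum_ite_eq',
        if_pos (hF e e.2).1, if_pos (hF e e.2).2]
    rw [h1, ← Finset.sum_add_distrib]
    simp only [L, Fintype.linearCombination_apply, w]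
    apply Finset.sum_congr rfl
    intro e _
    rw [← smul_add, add_sub_assoc]
  have hsum : ∀ z, ∑ v ∈ C, bd z v = 0 := by
    intro z
    simp_rw [hbd]
    rw [Finset.sum_comm]
    apply Finset.sum_eq_zero
    intro e _
    rw [← Finset.mul_sum, Finset.sum_sub_distrib, Finset.sum_ite_eq', Finset.sum_ite_eq',
        if_pos (hF e e.2).1, if_pos (hF e e.2).2]
    simp
  let R : (G.V → ℝ) →ₗ[ℝ] (↥(C.erase c0) → ℝ) :=
    LinearMap.funLeft ℝ ℝ (fun v => (v : G.V))
  let K : LinearMap.ker L →ₗ[ℝ] (↥(C.erase c0) → ℝ) :=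
    (R ∘ₗ bd) ∘ₗ (LinearMap.ker L).subtype
  have hK : Function.Injective K := by
    rw [← LinearMap.ker_eq_bot, LinearMap.ker_eq_bot']
    rintro ⟨z, hz⟩ h
    have hv : ∀ v ∈ C.erase c0, bd z v = 0 := fun v hv => congrFun h ⟨v, hv⟩
    have h0 : bd z c0 = 0 := by
      have := hsum z
      rw [← Finset.add_sum_erase _ _ hc0, Finset.sum_eq_zero hv, add_zero] at this
      exact this
    have hall : ∀ v ∈ C, bd z v = 0 := by
      intro v hvC
      by_cases hvc : v = c0
      · rw [hvc, h0]
      · exact hv v (Finset.mem_erase.2 ⟨hvc, hvC⟩)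
    have hz' : L z = 0 := hz
    rw [hL, Finset.sum_eq_zero (s := C) (fun v hv => by rw [hall v hv, zero_smul]), add_zero] at hz'
    ext e
    have := congrFun hz' e
    simpa [Finset.sum_apply, Pi.single_apply, Subtype.coe_inj] using this
  have hker := LinearMap.finrank_le_finrank_of_injective hK
  have hrn := LinearMap.finrank_range_add_finrank_ker L
  simp only [Module.finrank_fintype_fun_eq_card, Fintype.card_coe] at hker hrn
  rw [Finset.card_erase_of_mem hc0] at hker
  have hCpos : 0 < C.card := Finset.card_pos.2 ⟨c0, hc0⟩
  have hr : n ≤ Module.finrank ℝ (LinearMap.range L) := by omega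
  rw [Fintype.range_linearCombination] at hr
  obtain ⟨κ, a, ha, hspan, hli⟩ := exists_linearIndependent' ℝ w
  have : Finite κ := Finite.of_injective a ha
  have : Fintype κ := Fintype.ofFinite κ
  rw [← hspan, finrank_span_eq_card hli] at hr
  obtain ⟨f⟩ := Function.Embedding.nonempty_of_card_le (α := Fin n) (β := κ) (by simpa using hr)
  exact ⟨a ∘ f, hli.comp f f.injective⟩

/-- From a ball with many short edges we get the desired loops. -/
lemma loops_of_ball (hc : G.Connected) (x : G.V) (C : Finset G.V) (F : Finset G.E)
    (hF : ∀ e ∈ F, G.s e ∈ C ∧ G.t e ∈ C) (n : ℕ) (hC : C.Nonempty)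
    (hn : C.card + n ≤ F.card + 1) {D lam η M : ℝ} (hη : 0 < η)
    (hD : ∀ v ∈ C, G.vdist x v ≤ D) (hlam : ∀ e ∈ F, G.len e ≤ lam)
    (hM : 2 * (D + η) + lam ≤ M) :
    ∃ (x : G.V) (c : Fin n → List (G.E × Bool)),
      (∀ i, G.IsWalk x x (c i)) ∧ (∀ i, G.walkLen (c i) ≤ M) ∧
      LinearIndependent ℝ (fun i => G.cycVec (c i)) := by
  choose P hP hPl using fun v => exists_walk hc x v hη
  obtain ⟨a, ha⟩ := rank_lemma C F hF (fun v => G.cycVec (P v)) n hC hn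
  refine ⟨x, fun i => P (G.s (a i)) ++ ([((a i : G.E), true)] ++ rev (P (G.t (a i)))),
    ?_, ?_, ?_⟩
  · intro i
    refine (hP _).append (IsWalk.append (v := G.t (a i)) ?_ (hP _).rev)
    simp [IsWalk, dstart, dend]
  · intro i
    rw [walkLen_append, walkLen_append, walkLen_rev, walkLen_single]
    have h1 := hPl (G.s (a i))
    have h2 := hPl (G.t (a i))
    have h3 := hD _ (hF _ (a i).2).1
    have h4 := hD _ (hF _ (a i).2).2
    have h5 := hlam _ (a i).2
    simp only
    linarith
  · convert ha using 2 with i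
    rw [cycVec_append, cycVec_append, cycVec_rev, cycVec_single]
    abel

/-- Packing: few separated centers. -/
lemma packing (hc : G.Connected) (S : Finset G.V) {ρ : ℝ} (hρ : 0 ≤ ρ)
    (hS : ∀ i ∈ S, ∀ j ∈ S, i ≠ j → 2 * ρ ≤ G.vdist i j) (h2 : 2 ≤ S.card) :
    S.card * ρ ≤ G.totalLength := by
  classical
  have h1 : ∀ i ∈ S, ρ ≤ vol (G.vdist i) Finset.univ ρ := by
    intro i hi
    obtain ⟨j, hj, hji⟩ := Finset.exists_mem_ne (by omega : 1 < S.card) i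
    have := hS i hi j hj hji.symm
    exact vol_ge i j hc hρ (by linarith)
  have hedge : ∀ e : G.E, ∑ i ∈ S,
      |min (G.vdist i (G.s e)) ρ - min (G.vdist i (G.t e)) ρ| ≤ G.len e := by
    intro e
    set f : G.V → ℝ := fun i => |min (G.vdist i (G.s e)) ρ - min (G.vdist i (G.t e)) ρ| with hf
    have huniq : ∀ v : G.V, ∀ i ∈ S, ∀ j ∈ S, G.vdist i v < ρ → G.vdist j v < ρ → i = j := by
      intro v i hi j hj h1 h2
      by_contra hne
      have h3 := hS i hi j hj hne
      have h4 := vdist_triangle hc i v j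
      rw [vdist_comm hc v j] at h4
      linarith
    have hone : ∀ i, f i ≤ G.len e := fun i => (clamp_le _ _ _).trans (abs_vdist_edge hc i e)
    have hzero : ∀ i, ρ ≤ G.vdist i (G.s e) → ρ ≤ G.vdist i (G.t e) → f i = 0 := by
      intro i h1 h2
      simp [hf, min_eq_right h1, min_eq_right h2]
    have hsing : ∀ i ∈ S, (∀ j ∈ S, j ≠ i → f j = 0) → ∑ i ∈ S, f i ≤ G.len e := by
      intro i hi h
      rw [Finset.sum_eq_single_of_mem i hi h]
      exact hone i
    by_cases hA : ∃ i ∈ S, G.vdist i (G.s e) < ρ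
    · obtain ⟨i, hi, hid⟩ := hA
      by_cases hB : ∃ j ∈ S, j ≠ i ∧ G.vdist j (G.t e) < ρ
      · obtain ⟨j, hj, hji, hjd⟩ := hB
        have hsub : ∑ k ∈ S, f k = ∑ k ∈ {i, j}, f k := by
          symm
          apply Finset.sum_subset
          · intro k hk
            simp only [Finset.mem_insert, Finset.mem_singleton] at hk
            rcases hk with rfl | rfl <;> assumption
          · intro k hk hk'
            simp only [Finset.mem_insert, Finset.mem_singleton, not_or] at hk'
            apply hzero
            · by_contra! h
              exact hk'.1 (huniq _ k hk i hi h hid)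
            · by_contra! h
              exact hk'.2 (huniq _ k hk j hj h hjd)
        rw [hsub, Finset.sum_pair hji.symm]
        have hit : ρ ≤ G.vdist i (G.t e) := by
          by_contra! h
          exact hji (huniq _ j hj i hi hjd h)
        have hjs : ρ ≤ G.vdist j (G.s e) := by
          by_contra! h
          exact hji (huniq _ j hj i hi h hid)
        have e1 : f i = ρ - G.vdist i (G.s e) := by
          simp only [hf]
          rw [min_eq_left hid.le, min_eq_right hit, abs_sub_comm, abs_of_nonneg (by linarith)]
        have e2 : f j = ρ - G.vdist j (G.t e) := by
          simp only [hf]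
          rw [min_eq_left hjd.le, min_eq_right hjs, abs_of_nonneg (by linarith)]
        have t1 := vdist_triangle hc i (G.s e) j
        have t2 := vdist_triangle hc (G.s e) (G.t e) j
        rw [vdist_comm hc (G.t e) j] at t2
        have t3 := vdist_edge e
        have t4 := hS i hi j hj hji.symm
        linarith
      · push Not at hB
        refine hsing i hi fun j hj hji => hzero j ?_ (hB j hj hji)
        by_contra! h
        exact hji (huniq _ j hj i hi h hid)
    · push Not at hA
      by_cases hB : ∃ j ∈ S, G.vdist j (G.t e) < ρ
      · obtain ⟨j, hj, hjd⟩ := hB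
        refine hsing j hj fun i hi hij => hzero i (hA i hi) ?_
        by_contra! h
        exact hij (huniq _ i hi j hj h hjd)
      · push Not at hB
        rw [Finset.sum_eq_zero fun i hi => hzero i (hA i hi) (hB i hi)]
        exact G.len_nonneg e
  calc (S.card : ℝ) * ρ = ∑ i ∈ S, ρ := by simp
    _ ≤ ∑ i ∈ S, vol (G.vdist i) Finset.univ ρ := Finset.sum_le_sum h1
    _ = ∑ e, ∑ i ∈ S, |min (G.vdist i (G.s e)) ρ - min (G.vdist i (G.t e)) ρ| := by
        unfold vol; rw [Finset.sum_comm]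
    _ ≤ G.totalLength := Finset.sum_le_sum fun e _ => hedge e

open Classical in
/-- Short edges inside a vertex set. -/
noncomputable def inside (F : Finset G.E) (U : Finset G.V) : Finset G.E :=
  F.filter fun e => G.s e ∈ U ∧ G.t e ∈ U

/-- The decomposition argument. -/
lemma decomp (hc : G.Connected) (F : Finset G.E) {a δ ε σ m : ℝ} (hδ : 0 ≤ δ) (hε : 0 ≤ ε)
    (hbig : σ + G.totalLength < Real.exp (ε * δ) * σ)
    (hball : ∀ (x : G.V) (C : Finset G.V), (∀ v ∈ C, G.vdist x v ≤ a + δ) →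
      ((inside F C).card : ℝ) ≤ C.card + m) :
    ∀ (S : List G.V) (U : Finset G.V), (∀ u ∈ U, ∃ x ∈ S, G.vdist x u ≤ a) →
      ((inside F U).card : ℝ) ≤ U.card + S.length * m +
        ε * (∑ e ∈ inside F U, G.len e + S.length * σ) := by
  classical
  intro S
  induction S with
  | nil =>
    intro U hU
    have : U = ∅ := by
      by_contra h
      obtain ⟨u, hu⟩ := Finset.nonempty_iff_ne_empty.2 h
      obtain ⟨x, hx, -⟩ := hU u hu
      simp at hx
    subst this
    simp [inside]
  | cons x S ih =>
    intro U hU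
    have hvol : ∀ r, vol (G.vdist x) (inside F U) r ≤ G.totalLength := by
      intro r
      calc _ ≤ ∑ e ∈ inside F U, G.len e :=
            Finset.sum_le_sum fun e _ => (clamp_le _ _ _).trans (abs_vdist_edge hc x e)
        _ ≤ _ := Finset.sum_le_univ_sum_of_nonneg G.len_nonneg
    obtain ⟨r, hr1, hr2, hr⟩ := exists_radius (G.vdist x) (inside F U) (a := a) (δ := δ) (ε := ε)
      (σ := σ) hδ (fun r => by have := hvol r; linarith)
    set C := U.filter (fun v => G.vdist x v ≤ r) with hCdef
    set U' := U.filter (fun v => ¬ G.vdist x v ≤ r) with hU'def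
    have hcardU : C.card + U'.card = U.card := Finset.card_filter_add_card_filter_not _
    have hb := hball x C (fun v hv => (Finset.mem_filter.1 hv).2.trans hr2)
    have hi := ih U' (by
      intro u hu
      obtain ⟨huU, hur⟩ := Finset.mem_filter.1 hu
      obtain ⟨y, hy, hyd⟩ := hU u huU
      rcases List.mem_cons.1 hy with rfl | hy
      · exact absurd (hyd.trans hr1) hur
      · exact ⟨y, hy, hyd⟩)
    have hsub : inside F U ⊆ (inside F C ∪ inside F U') ∪
        crossing (G.vdist x) (inside F U) r := by
      intro e he
      have he' := he
      simp only [inside, Finset.mem_filter] at he'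
      simp only [inside, crossing, Finset.mem_union, Finset.mem_filter, hCdef, hU'def]
      tauto
    have hcard : ((inside F U).card : ℝ) ≤ (inside F C).card + (inside F U').card +
        (crossing (G.vdist x) (inside F U) r).card := by
      have h1 := Finset.card_le_card hsub
      have h2 := Finset.card_union_le (inside F C ∪ inside F U')
        (crossing (G.vdist x) (inside F U) r)
      have h3 := Finset.card_union_le (inside F C) (inside F U')
      exact_mod_cast (by omega)
    have hsub' : inside F U' ⊆ inside F U := by
      intro e he
      simp only [inside, Finset.mem_filter, hU'def] at he ⊢
      tauto
    have hv : vol (G.vdist x) (inside F U) r + ∑ e ∈ inside F U', G.len e ≤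
        ∑ e ∈ inside F U, G.len e := by
      unfold vol
      rw [← Finset.sum_sdiff hsub', ← Finset.sum_sdiff (f := fun e => G.len e) hsub']
      have z : ∑ e ∈ inside F U',
          |min (G.vdist x (G.s e)) r - min (G.vdist x (G.t e)) r| = 0 := by
        apply Finset.sum_eq_zero
        intro e he
        simp only [inside, Finset.mem_filter, hU'def, not_le] at he
        rw [min_eq_right he.2.1.2.le, min_eq_right he.2.2.2.le]
        simp
      rw [z, add_zero]
      gcongr with e he
      exact (clamp_le _ _ _).trans (abs_vdist_edge hc x e)
    have hv' := mul_le_mul_of_nonneg_left hv hε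
    have hcU : (C.card : ℝ) + U'.card = U.card := by exact_mod_cast hcardU
    simp only [List.length_cons]
    push_cast
    nlinarith

end MGraph
open MGraph in
/-- Let `Γ` be a connected metric graph of first Betti number `b ≥ 2`
and total length `b`, and let `n ∈ {1,...,b}`. Then there exist at least `n`
homologically independent loops in `Γ` based at the same point, each of length at
most `24(log b + n)`. -/
theorem short_homologically_independent_loops (G : MGraph) (b n : ℕ) (hb : 2 ≤ b)
    (hn1 : 1 ≤ n) (hnb : n ≤ b)
    (hconn : G.Connected) (hbetti : G.bettiEq b) (hlen : G.totalLength = b) :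
    ∃ (x : G.V) (c : Fin n → List (G.E × Bool)),
      (∀ i, G.IsWalk x x (c i)) ∧
      (∀ i, G.walkLen (c i) ≤ 24 * (Real.log b + n)) ∧
      LinearIndependent ℝ (fun i => G.cycVec (c i)) := by
  classical
  by_contra hcon
  have hbR : (2 : ℝ) ≤ b := by exact_mod_cast hb
  have hnR : (1 : ℝ) ≤ n := by exact_mod_cast hn1
  have hlog : 0 < Real.log b := Real.log_pos (by linarith)
  unfold bettiEq at hbetti
  have hV : Nonempty G.V := by
    by_contra h
    rw [not_nonempty_iff] at h
    have : IsEmpty G.E := ⟨fun e => h.elim (G.s e)⟩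
    simp at hbetti
    omega
  -- short edges
  set F : Finset G.E := Finset.univ.filter (fun e => G.len e ≤ 8 * n) with hFdef
  set Fc : Finset G.E := Finset.univ.filter (fun e => ¬ G.len e ≤ 8 * n) with hFcdef
  have hFF : F.card + Fc.card = Fintype.card G.E := Finset.card_filter_add_card_filter_not _
  have hlong : (Fc.card : ℝ) * (8 * n) ≤ b := by
    calc (Fc.card : ℝ) * (8 * n) = ∑ e ∈ Fc, (8 * n : ℝ) := by simp
      _ ≤ ∑ e ∈ Fc, G.len e := Finset.sum_le_sum fun e he =>
          (not_le.1 (Finset.mem_filter.1 he).2).le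
      _ ≤ G.totalLength := Finset.sum_le_univ_sum_of_nonneg G.len_nonneg
      _ = b := hlen
  -- every ball has small Betti number
  have hball1 : ∀ (x : G.V) (C : Finset G.V), C.Nonempty →
      (∀ v ∈ C, G.vdist x v ≤ 8 * n + 10 * Real.log b) →
      (inside F C).card + 1 < C.card + n := by
    intro x C hC hD
    by_contra! h
    apply hcon
    refine loops_of_ball hconn x C (inside F C) ?_ n hC h hlog hD (lam := 8 * n) ?_ ?_
    · intro e he
      exact (Finset.mem_filter.1 he).2
    · intro e he
      exact (Finset.mem_filter.1 (Finset.mem_filter.1 he).1).2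
    · nlinarith
  have hball : ∀ (x : G.V) (C : Finset G.V),
      (∀ v ∈ C, G.vdist x v ≤ 8 * n + 10 * Real.log b) →
      ((inside F C).card : ℝ) ≤ C.card + ((n : ℝ) - 1) := by
    intro x C hD
    rcases C.eq_empty_or_nonempty with rfl | hC
    · simp [inside, hnR]
    · have := hball1 x C hC hD
      have h2 : ((inside F C).card : ℝ) + 1 ≤ C.card + n := by exact_mod_cast this.le
      linarith
  have hin : inside F Finset.univ = F := by simp [inside]
  -- maximal separated set
  obtain ⟨S, hS, hmax⟩ : ∃ S : Finset G.V,
      (∀ i ∈ S, ∀ j ∈ S, i ≠ j → 2 * (4 * n : ℝ) ≤ G.vdist i j) ∧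
      ∀ v, ∃ x ∈ S, G.vdist x v ≤ 8 * n := by
    obtain ⟨S, hS⟩ := Set.Finite.exists_maximal
      (s := {S : Finset G.V | ∀ i ∈ S, ∀ j ∈ S, i ≠ j → 2 * (4 * n : ℝ) ≤ G.vdist i j})
      (Set.toFinite _) ⟨∅, by simp⟩
    refine ⟨S, hS.1, ?_⟩
    intro v
    by_contra! h
    have hv : v ∉ S := by
      intro hv
      have := h v hv
      rw [vdist_self] at this
      linarith
    have hm : insert v S ∈ {S : Finset G.V |
        ∀ i ∈ S, ∀ j ∈ S, i ≠ j → 2 * (4 * n : ℝ) ≤ G.vdist i j} := by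
      intro i hi j hj hij
      rcases Finset.mem_insert.1 hi with hi1 | hi1 <;>
        rcases Finset.mem_insert.1 hj with hj1 | hj1
      · exact absurd (hi1.trans hj1.symm) hij
      · have := h j hj1
        rw [vdist_comm hconn, hi1]; linarith
      · have := h i hi1
        rw [hj1]; linarith
      · exact hS.1 i hi1 j hj1 hij
    exact hv (hS.2 hm (Finset.subset_insert v S) (Finset.mem_insert_self v S))
  by_cases h2 : 2 ≤ S.card
  · have hp := packing hconn S (by positivity) hS h2
    rw [hlen] at hp
    have hd := decomp hconn F (a := 8 * n) (δ := 10 * Real.log b) (ε := 1 / 10) (σ := 4 * n)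
      (m := n - 1) (by positivity) (by norm_num) (by
        rw [hlen, show (1 / 10 : ℝ) * (10 * Real.log b) = Real.log b by ring,
          Real.exp_log (by linarith)]
        nlinarith) hball S.toList Finset.univ (by
        intro u _
        simpa using hmax u)
    rw [hin, Finset.length_toList, Finset.card_univ] at hd
    have hl : ∑ e ∈ F, G.len e ≤ b := by
      rw [← hlen]; exact Finset.sum_le_univ_sum_of_nonneg G.len_nonneg
    have hbe : (Fintype.card G.E : ℝ) - Fintype.card G.V + 1 = b := by exact_mod_cast hbetti
    have hFFR : (F.card : ℝ) + Fc.card = Fintype.card G.E := by exact_mod_cast hFF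
    have hk : (S.card : ℝ) * (n - 1) ≤ b / 4 - S.card := by linarith
    have hk2 : (2 : ℝ) ≤ S.card := by exact_mod_cast h2
    have hl8 : (Fc.card : ℝ) ≤ b / 8 := by nlinarith
    -- b - 1 ≤ b/4 - 2 + b/5 + b/8
    nlinarith
  · obtain ⟨v0⟩ := hV
    obtain ⟨x, hx, -⟩ := hmax v0
    have hall : ∀ v, G.vdist x v ≤ 8 * n := by
      intro v
      obtain ⟨y, hy, hyd⟩ := hmax v
      have : y = x := Finset.card_le_one.1 (by omega) y hy x hx
      rwa [this] at hyd
    have h := hball1 x Finset.univ ⟨v0, Finset.mem_univ _⟩ (fun v _ => by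
      have := hall v; linarith)
    rw [hin, Finset.card_univ] at h
    have hlongN : Fc.card * (8 * n) ≤ b := by exact_mod_cast hlong
    rcases Nat.eq_zero_or_pos Fc.card with h0 | h0
    · omega
    · have h8 : 8 * Fc.card ≤ b := by nlinarith
      have h9 : 8 * n ≤ b := by nlinarith
      omega
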